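/- Let p be an odd prime, q = p^m with q = 2^a·b + 1, b odd, a ≥ 2, let r ≥ 2, and N = 2^r·p^s. Then the number of ideals C of R = F_q[x]/(x^N − 1) satisfying C^⊥ ⊆ C equals (p^s+2)^{2^{r−1}−1} · ((p^s+1)/2)^{2^{r−1}+1} if r ≤ a, and equals (p^s+2)^{2^{a−1}+(r−a)·2^{a−2}−1} · ((p^s+1)/2)^{2^{a−1}+(r−a)·2^{a−2}+1} if r > a. -/

import Mathlib

open Polynomial

/-- The coefficient vector (with respect to the basis `1, x, …, x^{deg f − 1}` of
`F[x]/(f)`) of an element of `F[x]/(f)`. -/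
noncomputable def coeffRepr {F : Type*} [Field F] {f : Polynomial F} (hf : f ≠ 0)
    (x : AdjoinRoot f) (i : Fin (AdjoinRoot.powerBasis hf).dim) : F :=
  (AdjoinRoot.powerBasis hf).basis.repr x i

/-- The (Euclidean) dual code of a cyclic code `C ⊆ F[x]/(f)`. -/
noncomputable def dualCode {F : Type*} [Field F] {f : Polynomial F} (hf : f ≠ 0)
    (C : Ideal (AdjoinRoot f)) : Set (AdjoinRoot f) :=
  {x | ∀ y ∈ C, ∑ i, coeffRepr hf x i * coeffRepr hf y i = 0}

theorem card_two_mul_le (P : ℕ) (hP : Odd P) : Nat.card {i : ℕ // i + i ≤ P} = (P + 1) / 2 := by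
  obtain ⟨t, rfl⟩ := hP
  have : {i : ℕ // i + i ≤ 2 * t + 1} ≃ Fin (t + 1) :=
    { toFun := fun i => ⟨i.1, by have := i.2; omega⟩
      invFun := fun i => ⟨i.1, by have := i.2; omega⟩
      left_inv := fun _ => rfl
      right_inv := fun _ => rfl }
  rw [Nat.card_congr this, Nat.card_fin]
  omega

theorem card_add_le (P : ℕ) :
    Nat.card {i : ℕ × ℕ // i.1 + i.2 ≤ P} = (P + 1) * (P + 2) / 2 := by
  let e : {i : ℕ × ℕ // i.1 + i.2 ≤ P} ≃ Σ i : Fin (P + 1), Fin (i + 1) :=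
    { toFun := fun i => ⟨⟨i.1.1 + i.1.2, by have := i.2; omega⟩, ⟨i.1.1, by simp⟩⟩
      invFun := fun i => ⟨(i.2, i.1 - i.2), by have := i.1.2; have := i.2.2; simp; omega⟩
      left_inv := fun i => by ext <;> simp
      right_inv := by
        rintro ⟨⟨i, hi⟩, ⟨j, hj⟩⟩
        have h : j + (i - j) = i := by simp at hj; omega
        refine Sigma.ext (Fin.ext h) ?_
        simp only
        congr 1 <;> simp [h] }
  rw [Nat.card_congr e, Nat.card_sigma]
  simp only [Nat.card_fin]
  rw [Fin.sum_univ_eq_sum_range (fun i => i + 1)]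
  have := Finset.sum_range_succ' (fun i => i) (P + 1)
  rw [add_zero] at this
  rw [← this, Finset.sum_range_id, mul_comm]
  rfl

/-- For an involution `τ`, a function `k` with `k x + k (τ x) ≤ P` is determined by its values on
the fixed points and by its pairs of values on one representative of each two-element orbit. -/
noncomputable def involutionBoundedEquiv {S : Type*} [LinearOrder S] (τ : S → S)
    (hτ : Function.Involutive τ) (P : ℕ) :
    {k : S → ℕ // ∀ x, k x + k (τ x) ≤ P} ≃
      ({x // τ x = x} → {i : ℕ // i + i ≤ P}) ×
        ({x // x < τ x} → {i : ℕ × ℕ // i.1 + i.2 ≤ P}) where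
  toFun k := (fun x => ⟨k.1 x, by have := k.2 x; rwa [x.2] at this⟩,
    fun x => ⟨(k.1 x, k.1 (τ x)), k.2 x⟩)
  invFun l := ⟨fun x => if h : τ x = x then (l.1 ⟨x, h⟩).1
      else if h' : x < τ x then (l.2 ⟨x, h'⟩).1.1
      else (l.2 ⟨τ x, by rw [hτ]; exact lt_of_le_of_ne (not_lt.1 h') h⟩).1.2, fun x => by
    have := hτ x
    rcases lt_trichotomy (τ x) x with h | h | h
    · simpa [h.ne, h.ne', h, h.not_gt, this, add_comm] using (l.2 ⟨τ x, by rwa [hτ]⟩).2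
    · simpa [h] using (l.1 ⟨x, h⟩).2
    · simpa [h.ne, h.ne', h, h.not_gt, this] using (l.2 ⟨x, h⟩).2⟩
  left_inv k := by
    ext x
    have := hτ x
    rcases lt_trichotomy (τ x) x with h | h | h
    · simp [h.ne, h.not_gt, this]
    · simp [h]
    · simp [h.ne', h]
  right_inv l := by
    refine Prod.ext ?_ ?_
    · ext x
      simp [x.2]
    · ext x
      · simp [x.2, x.2.ne']
      · have := hτ x
        simp [x.2.ne, x.2.not_gt, this]

theorem card_involution_bounded {S : Type*} [Finite S] (τ : S → S)
    (hτ : Function.Involutive τ) (P M : ℕ) (hP : Odd P)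
    (hfix : Nat.card {x // τ x = x} = 2) (hS : Nat.card S = 2 * M + 2) :
    Nat.card {k : S → ℕ // ∀ x, k x + k (τ x) ≤ P} =
      (P + 2) ^ M * ((P + 1) / 2) ^ (M + 2) := by
  classical
  let _ : LinearOrder S := linearOrderOfSTO WellOrderingRel
  have := Fintype.ofFinite S
  have hlt : Nat.card {x // x < τ x} = M := by
    have h1 : Nat.card {x // x < τ x} = Nat.card {x // τ x < x} :=
      Nat.card_congr
        { toFun := fun x => ⟨τ x, by rw [hτ]; exact x.2⟩
          invFun := fun x => ⟨τ x, by rw [hτ]; exact x.2⟩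
          left_inv := fun x => Subtype.ext (hτ x)
          right_inv := fun x => Subtype.ext (hτ x) }
    have h2 : Nat.card S = Nat.card {x // τ x = x} +
        (Nat.card {x // x < τ x} + Nat.card {x // τ x < x}) := by
      simp only [Nat.card_eq_fintype_card, Fintype.card_subtype]
      rw [← Finset.card_union_of_disjoint, ← Finset.card_union_of_disjoint, ← Finset.card_univ]
      · congr 1
        ext x
        have := lt_trichotomy (τ x) x
        simp
        tauto
      · rw [Finset.disjoint_left]
        intro x
        simp +contextual
      · rw [Finset.disjoint_left]
        intro x
        simpa using le_of_lt
    omega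
  rw [Nat.card_congr (involutionBoundedEquiv τ hτ P), Nat.card_prod, Nat.card_fun, Nat.card_fun,
    hfix, hlt, card_two_mul_le P hP, card_add_le]
  obtain ⟨t, rfl⟩ := hP
  have h1 : (2 * t + 1 + 1) / 2 = t + 1 := by omega
  have h2 : (2 * t + 1 + 1) * (2 * t + 1 + 2) / 2 = (t + 1) * (2 * t + 1 + 2) := by
    rw [show (2 * t + 1 + 1) * (2 * t + 1 + 2) = 2 * ((t + 1) * (2 * t + 1 + 2)) by ring]
    simp
  rw [h1, h2, mul_pow]
  ring

section Dual

variable {F : Type*} [Field F]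

/-- The mirror of polynomials as a multiplicative equivalence. -/
noncomputable def mirrorEquiv : F[X] ≃* F[X] where
  toFun := mirror
  invFun := mirror
  left_inv p := mirror_mirror p
  right_inv p := mirror_mirror p
  map_mul' p q := mirror_mul_of_domain p q

theorem mirrorEquiv_apply (p : F[X]) : mirrorEquiv p = p.mirror := rfl

theorem irreducible_mirror {p : F[X]} (hp : Irreducible p) : Irreducible p.mirror :=
  (MulEquiv.irreducible_iff (mirrorEquiv (F := F)) (x := p)).2 hp

theorem mirror_dvd_mirror {p q : F[X]} (h : p ∣ q) : p.mirror ∣ q.mirror := by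
  obtain ⟨c, rfl⟩ := h
  exact ⟨c.mirror, mirror_mul_of_domain p c⟩

theorem mirror_X_pow_sub_C {N : ℕ} (hN : 0 < N) {c : F} (hc : c ≠ 0) :
    (X ^ N - C c).mirror = 1 - C c * X ^ N := by
  have h0 : (X ^ N - C c).natTrailingDegree = 0 := by
    apply natTrailingDegree_eq_zero_of_constantCoeff_ne_zero
    simp [coeff_X_pow, hN.ne, hc]
  rw [mirror, h0, pow_zero, mul_one, reverse, natDegree_X_pow_sub_C, reflect_sub, reflect_C,
    reflect_monomial]
  simp

theorem mirror_X_pow_sub_one {N : ℕ} (hN : 0 < N) :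
    (X ^ N - 1 : F[X]).mirror = -(X ^ N - 1) := by
  simpa using mirror_X_pow_sub_C hN (one_ne_zero (α := F))

variable {N : ℕ} (hf : (X ^ N - 1 : F[X]) ≠ 0)

local notation "α" => AdjoinRoot.root (X ^ N - 1 : F[X])

theorem root_X_pow_sub_one_pow : α ^ N = 1 := by
  have h := AdjoinRoot.eval₂_root (X ^ N - 1 : F[X])
  simpa [sub_eq_zero] using h

theorem pos_of_X_pow_sub_one_ne_zero (hf : (X ^ N - 1 : F[X]) ≠ 0) : 0 < N := by
  rcases Nat.eq_zero_or_pos N with rfl | h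
  · simp at hf
  · exact h

theorem powerBasis_dim_X_pow_sub_one : (AdjoinRoot.powerBasis hf).dim = N := by
  rw [AdjoinRoot.powerBasis_dim]
  simpa using natDegree_X_pow_sub_C (n := N) (r := (1 : F))

theorem coeffRepr_root_pow (k : ℕ) (i : Fin (AdjoinRoot.powerBasis hf).dim) :
    coeffRepr hf (α ^ k) i = if k % N = i then 1 else 0 := by
  have hN := pos_of_X_pow_sub_one_ne_zero hf
  have hlt : k % N < (AdjoinRoot.powerBasis hf).dim := by
    rw [powerBasis_dim_X_pow_sub_one]
    exact Nat.mod_lt _ hN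
  have hk : α ^ k = (AdjoinRoot.powerBasis hf).basis ⟨k % N, hlt⟩ := by
    rw [PowerBasis.basis_eq_pow]
    simp only [AdjoinRoot.powerBasis_gen]
    conv_lhs => rw [← Nat.div_add_mod k N, pow_add, pow_mul, root_X_pow_sub_one_pow, one_pow,
      one_mul]
  rw [coeffRepr, hk, Module.Basis.repr_self, Finsupp.single_apply]
  simp [Fin.ext_iff]

/-- The involution `x ↦ x⁻¹` of the ambient ring of cyclic codes. -/
noncomputable def conjHom (F : Type*) [Field F] (N : ℕ) :
    AdjoinRoot (X ^ N - 1 : F[X]) →ₐ[F] AdjoinRoot (X ^ N - 1 : F[X]) :=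
  AdjoinRoot.liftAlgHom (X ^ N - 1 : F[X]) (Algebra.ofId F _)
    (AdjoinRoot.root _ ^ (N - 1)) (by
      simp only [eval₂_sub, eval₂_one, eval₂_X_pow]
      rw [← pow_mul, mul_comm, pow_mul, root_X_pow_sub_one_pow, one_pow, sub_self])

theorem conjHom_root : conjHom F N α = α ^ (N - 1) := by
  simp [conjHom]

theorem coeffRepr_add (x y : AdjoinRoot (X ^ N - 1 : F[X])) (i) :
    coeffRepr hf (x + y) i = coeffRepr hf x i + coeffRepr hf y i := by
  simp [coeffRepr]

theorem coeffRepr_smul (c : F) (x : AdjoinRoot (X ^ N - 1 : F[X])) (i) :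
    coeffRepr hf (c • x) i = c * coeffRepr hf x i := by
  simp [coeffRepr]

/-- The Euclidean inner product as a bilinear form. -/
noncomputable def codePairing :
    AdjoinRoot (X ^ N - 1 : F[X]) →ₗ[F] AdjoinRoot (X ^ N - 1 : F[X]) →ₗ[F] F :=
  LinearMap.mk₂ F (fun x y => ∑ i, coeffRepr hf x i * coeffRepr hf y i)
    (fun _ _ _ => by simp only [coeffRepr_add, add_mul, Finset.sum_add_distrib])
    (fun _ _ _ => by simp only [coeffRepr_smul, mul_assoc, Finset.mul_sum, smul_eq_mul])
    (fun _ _ _ => by simp only [coeffRepr_add, mul_add, Finset.sum_add_distrib])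
    (fun _ _ _ => by simp only [coeffRepr_smul, mul_left_comm, Finset.mul_sum, smul_eq_mul])

theorem codePairing_apply (x y : AdjoinRoot (X ^ N - 1 : F[X])) :
    codePairing hf x y = ∑ i, coeffRepr hf x i * coeffRepr hf y i := rfl

theorem codePairing_root_pow (i j : ℕ) :
    codePairing hf (α ^ i) (α ^ j) = if i % N = j % N then 1 else 0 := by
  have hN := pos_of_X_pow_sub_one_ne_zero hf
  simp only [codePairing_apply, coeffRepr_root_pow]
  have hlt : i % N < (AdjoinRoot.powerBasis hf).dim := by
    rw [powerBasis_dim_X_pow_sub_one]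
    exact Nat.mod_lt _ hN
  rw [Finset.sum_eq_single ⟨i % N, hlt⟩]
  · simp [eq_comm]
  · intro b _ hb
    have : i % N ≠ b := fun h => hb (Fin.ext h.symm)
    simp [this]
  · simp

theorem codePairing_eq (x y : AdjoinRoot (X ^ N - 1 : F[X])) :
    codePairing hf x y = codePairing hf (x * conjHom F N y) 1 := by
  have hN := pos_of_X_pow_sub_one_ne_zero hf
  let B := (AdjoinRoot.powerBasis hf).basis
  have : codePairing hf = ((LinearMap.mul F _).compl₂ (conjHom F N).toLinearMap).compr₂
      ((codePairing hf).flip 1) := by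
    refine LinearMap.ext_basis B B fun i j => ?_
    simp only [B, PowerBasis.basis_eq_pow, AdjoinRoot.powerBasis_gen, LinearMap.compr₂_apply,
      LinearMap.compl₂_apply, LinearMap.mul_apply', LinearMap.flip_apply, AlgHom.toLinearMap_apply,
      map_pow, conjHom_root]
    rw [← pow_mul, ← pow_add, ← pow_zero α, codePairing_root_pow, codePairing_root_pow]
    congr 1
    rw [← Nat.ModEq, ← Nat.ModEq, eq_iff_iff]
    have key : (N - 1) * j + j = N * j := by
      conv_lhs => rw [← Nat.succ_mul, Nat.succ_eq_add_one, Nat.sub_add_cancel hN]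
    constructor
    · intro h
      refine (h.add_right _).trans ?_
      rw [add_comm, key]
      exact (Nat.modEq_zero_iff_dvd.2 (dvd_mul_right _ _))
    · intro h
      have := h.add_right j
      rw [add_assoc, key, zero_add] at this
      exact (show (i : ℕ) ≡ i + N * j [MOD N] by simp [Nat.ModEq]).trans this
  exact LinearMap.congr_fun₂ this x y

theorem eq_zero_of_codePairing (z : AdjoinRoot (X ^ N - 1 : F[X]))
    (h : ∀ i : ℕ, codePairing hf z (α ^ i) = 0) : z = 0 := by
  apply (AdjoinRoot.powerBasis hf).basis.ext_elem
  intro i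
  have hi := i.2.trans_eq (powerBasis_dim_X_pow_sub_one hf)
  have := h i
  simp only [codePairing_apply, coeffRepr_root_pow, Nat.mod_eq_of_lt hi] at this
  rw [Finset.sum_eq_single i] at this
  · simpa [coeffRepr] using this
  · intro b _ hb
    have : (i : ℕ) ≠ b := fun h => hb (Fin.ext h.symm)
    simp [this]
  · simp

theorem mem_dualCode_span_iff (g x : AdjoinRoot (X ^ N - 1 : F[X])) :
    x ∈ dualCode hf (Ideal.span {g}) ↔ x * conjHom F N g = 0 := by
  have hmem : x ∈ dualCode hf (Ideal.span {g}) ↔ ∀ y ∈ Ideal.span {g}, codePairing hf x y = 0 :=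
    Iff.rfl
  rw [hmem]
  constructor
  · intro h
    apply eq_zero_of_codePairing hf
    intro i
    have := h (g * α ^ i) (Ideal.mul_mem_right _ _ (Ideal.mem_span_singleton_self g))
    rwa [codePairing_eq, map_mul (conjHom F N), ← mul_assoc, ← codePairing_eq] at this
  · intro h y hy
    obtain ⟨c, rfl⟩ := Ideal.mem_span_singleton'.1 hy
    rw [codePairing_eq, map_mul (conjHom F N), mul_left_comm, h]
    simp

theorem associated_mk_mirror (hN : 0 < N) (g : F[X]) :
    Associated (AdjoinRoot.mk (X ^ N - 1 : F[X]) g.mirror) (conjHom F N (AdjoinRoot.mk _ g)) := by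
  have hα : α * α ^ (N - 1) = 1 := by
    rw [← pow_succ', Nat.sub_add_cancel hN, root_X_pow_sub_one_pow]
  let u : (AdjoinRoot (X ^ N - 1 : F[X]))ˣ := ⟨α ^ (N - 1), α, by rw [mul_comm, hα], hα⟩
  have h1 : conjHom F N (AdjoinRoot.mk _ g) = eval₂ (AdjoinRoot.of _) (u : AdjoinRoot _) g := by
    simp only [conjHom, AdjoinRoot.liftAlgHom_mk]
    rfl
  have h2 : eval₂ (AdjoinRoot.of _) ((u⁻¹ : _ˣ) : AdjoinRoot (X ^ N - 1 : F[X])) g.reverse =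
      AdjoinRoot.mk _ g.reverse := by
    rw [show ((u⁻¹ : _ˣ) : AdjoinRoot (X ^ N - 1 : F[X])) = α from rfl, ← AdjoinRoot.aeval_eq]
    rfl
  let _ : Invertible (u : AdjoinRoot (X ^ N - 1 : F[X])) := u.invertible
  rw [h1, ← eval₂_reverse_mul_pow _ (u : AdjoinRoot (X ^ N - 1 : F[X])), invOf_units, h2, mirror,
    map_mul, map_pow, AdjoinRoot.mk_X]
  have hu : ∀ k, IsUnit ((u : AdjoinRoot (X ^ N - 1 : F[X])) ^ k) := fun k => u.isUnit.pow k
  have hu' : ∀ k, IsUnit (α ^ k) := fun k => (u⁻¹).isUnit.pow k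
  exact (associated_mul_unit_left _ _ (hu' _)).trans (associated_mul_unit_right _ _ (hu _))

theorem mk_mem_span_mk_iff {f g t : F[X]} (h : g ∣ f) :
    AdjoinRoot.mk f t ∈ Ideal.span {AdjoinRoot.mk f g} ↔ g ∣ t := by
  rw [Ideal.mem_span_singleton]
  constructor
  · rintro ⟨c, hc⟩
    obtain ⟨c, rfl⟩ := AdjoinRoot.mk_surjective c
    rw [← map_mul, AdjoinRoot.mk_eq_mk] at hc
    exact (dvd_sub_left (dvd_mul_right _ _)).1 (h.trans hc)
  · exact map_dvd _

theorem dualCode_subset_iff {g : F[X]} (hg : g ∣ X ^ N - 1) :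
    dualCode hf (Ideal.span {AdjoinRoot.mk _ g}) ⊆ ↑(Ideal.span {AdjoinRoot.mk (X ^ N - 1) g}) ↔
      g * g.mirror ∣ X ^ N - 1 := by
  have hN := pos_of_X_pow_sub_one_ne_zero hf
  have hmem : ∀ t, AdjoinRoot.mk _ t ∈ dualCode hf (Ideal.span {AdjoinRoot.mk _ g}) ↔
      X ^ N - 1 ∣ t * g.mirror := by
    intro t
    rw [mem_dualCode_span_iff, ← AdjoinRoot.mk_eq_zero, map_mul,
      ((associated_mk_mirror hN g).mul_left (AdjoinRoot.mk _ t)).eq_zero_iff]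
  obtain ⟨h, hh⟩ := hg
  have hm : X ^ N - 1 = -(h.mirror * g.mirror) := by
    rw [← mirror_mul_of_domain, mul_comm, ← hh, mirror_X_pow_sub_one hN, neg_neg]
  have hg0 : g.mirror ≠ 0 := by
    rintro h0
    rw [h0] at hm
    simp [hf] at hm
  have : g * g.mirror ∣ X ^ N - 1 ↔ g ∣ h.mirror := by
    rw [hm, dvd_neg, mul_dvd_mul_iff_right hg0]
  rw [this]
  constructor
  · intro hsub
    refine (mk_mem_span_mk_iff ⟨h, hh⟩).1 (hsub ((hmem _).2 ?_))
    rw [hm, neg_dvd]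
  · intro hd x hx
    obtain ⟨t, rfl⟩ := AdjoinRoot.mk_surjective x
    rw [hmem, hm, neg_dvd, mul_dvd_mul_iff_right hg0] at hx
    exact (mk_mem_span_mk_iff ⟨h, hh⟩).2 (hd.trans hx)

theorem exists_dvd_eq_span_mk (f : F[X]) (C : Ideal (AdjoinRoot f)) :
    ∃ g, g ∣ f ∧ C = Ideal.span {AdjoinRoot.mk f g} := by
  obtain ⟨g, hg⟩ := (IsPrincipalIdealRing.principal (C.comap (AdjoinRoot.mk f))).principal
  refine ⟨g, ?_, ?_⟩
  · rw [← Ideal.mem_span_singleton, Ideal.span, ← hg, Ideal.mem_comap, AdjoinRoot.mk_self]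
    exact C.zero_mem
  · rw [← Ideal.map_comap_of_surjective _ AdjoinRoot.mk_surjective C, hg, ← Ideal.span,
      Ideal.map_span, Set.image_singleton]

end Dual

section Factors

open UniqueFactorizationMonoid

theorem exists_associated_prod_pow {R ι : Type*} [CommRing R] [IsDomain R]
    [UniqueFactorizationMonoid R] (s : Finset ι) (f : ι → R) (hs : ∀ i ∈ s, Prime (f i)) (l : ι → ℕ)
    (g : R) (hg : g ∣ ∏ i ∈ s, f i ^ l i) : ∃ k : ι → ℕ, Associated g (∏ i ∈ s, f i ^ k i) := by
  classical
  induction s using Finset.induction_on generalizing g with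
  | empty => exact ⟨l, by simpa using isUnit_of_dvd_one (by simpa using hg)⟩
  | insert a s ha ih =>
    rw [Finset.prod_insert ha] at hg
    obtain ⟨g₁, g₂, h₁, h₂, rfl⟩ := exists_dvd_and_dvd_of_dvd_mul hg
    obtain ⟨m, -, hm⟩ := (dvd_prime_pow (hs a (Finset.mem_insert_self _ _)) _).1 h₁
    obtain ⟨k, hk⟩ := ih (fun i hi => hs i (Finset.mem_insert_of_mem hi)) g₂ h₂
    refine ⟨Function.update k a m, ?_⟩
    rw [Finset.prod_insert ha, Function.update_self]
    refine hm.mul_mul (hk.trans (Associated.of_eq (Finset.prod_congr rfl fun i hi => ?_)))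
    rw [Function.update_of_ne (ne_of_mem_of_not_mem hi ha)]

theorem le_of_prod_pow_dvd {R ι : Type*} [CommRing R] [IsDomain R] [Fintype ι] (f : ι → R)
    (hf : ∀ i, Prime (f i)) (hf' : ∀ i j, f i ∣ f j → i = j) (k l : ι → ℕ)
    (h : ∏ i, f i ^ k i ∣ ∏ i, f i ^ l i) : k ≤ l := by
  classical
  intro i
  have h1 := emultiplicity_le_emultiplicity_of_dvd_right (a := f i)
    ((Finset.dvd_prod_of_mem (fun i => f i ^ k i) (Finset.mem_univ i)).trans h)
  rw [emultiplicity_pow_self_of_prime (hf i), Finset.emultiplicity_prod (hf i),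
    Finset.sum_eq_single i] at h1
  · rw [emultiplicity_pow_self_of_prime (hf i)] at h1
    exact_mod_cast h1
  · intro j _ hj
    rw [emultiplicity_eq_zero]
    exact fun hd => hj (hf' i j ((hf i).dvd_of_dvd_pow hd)).symm
  · simp

variable {F : Type*} [Field F] [DecidableEq F]

theorem mem_primeFactors_iff_monic {f φ : F[X]} (hf : f ≠ 0) :
    φ ∈ primeFactors f ↔ Irreducible φ ∧ φ.Monic ∧ φ ∣ f := by
  rw [mem_primeFactors, mem_normalizedFactors_iff' hf]
  refine and_congr_right fun h => ?_
  rw [normalize_eq_self_iff_monic h.ne_zero]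

theorem irreducible_of_mem_primeFactors {f φ : F[X]} (h : φ ∈ primeFactors f) : Irreducible φ :=
  irreducible_of_normalized_factor φ (mem_primeFactors.1 h)

theorem eq_of_mem_primeFactors_of_dvd {f φ ψ : F[X]} (hφ : φ ∈ primeFactors f)
    (hψ : ψ ∈ primeFactors f) (h : φ ∣ ψ) : φ = ψ :=
  ((irreducible_of_mem_primeFactors hφ).associated_of_dvd (irreducible_of_mem_primeFactors hψ)
    h).eq_of_normalized (normalize_normalized_factor _ (mem_primeFactors.1 hφ))
      (normalize_normalized_factor _ (mem_primeFactors.1 hψ))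

theorem associated_prod_primeFactors {f : F[X]} (hf : Squarefree f) :
    Associated (∏ φ : primeFactors f, (φ : F[X])) f := by
  rw [Finset.prod_coe_sort (primeFactors f) fun φ => φ]
  exact radical_associated hf.isRadical hf.ne_zero

theorem associated_normalize_mirror (φ : F[X]) : Associated (normalize φ.mirror) φ.mirror :=
  normalize_associated _

/-- The reciprocal of a monic irreducible factor of a polynomial equal to its mirror up to a
unit. -/
noncomputable def mirrorFactor (f : F[X]) (hf : f ≠ 0) (hm : Associated f.mirror f)
    (φ : primeFactors f) : primeFactors f :=
  ⟨normalize φ.1.mirror, by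
    have h := (mem_primeFactors_iff_monic hf).1 φ.2
    have h0 : φ.1.mirror ≠ 0 := by simpa using h.1.ne_zero
    rw [mem_primeFactors_iff_monic hf]
    refine ⟨?_, Polynomial.monic_normalize h0, ?_⟩
    · rw [(associated_normalize_mirror _).irreducible_iff]
      exact irreducible_mirror h.1
    · rw [(associated_normalize_mirror _).dvd_iff_dvd_left, ← hm.dvd_iff_dvd_right]
      exact mirror_dvd_mirror h.2.2⟩

variable {f : F[X]} (hf : f ≠ 0) (hm : Associated f.mirror f)

theorem associated_mirrorFactor (φ : primeFactors f) :
    Associated (φ : F[X]).mirror (mirrorFactor f hf hm φ : F[X]) :=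
  (associated_normalize_mirror _).symm

theorem mirrorFactor_involutive : Function.Involutive (mirrorFactor f hf hm) := by
  intro φ
  refine Subtype.ext (eq_of_mem_primeFactors_of_dvd (Subtype.prop _) φ.2 ?_)
  rw [← (associated_mirrorFactor hf hm (mirrorFactor f hf hm φ)).dvd_iff_dvd_left]
  have := mirror_dvd_mirror (associated_mirrorFactor hf hm φ).symm.dvd
  rwa [mirror_mirror] at this

theorem associated_mirror_prod_pow (k : primeFactors f → ℕ) :
    Associated (∏ φ : primeFactors f, (φ : F[X]) ^ k φ).mirror
      (∏ φ : primeFactors f, (φ : F[X]) ^ k (mirrorFactor f hf hm φ)) := by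
  have hinv := mirrorFactor_involutive hf hm
  have h1 : (∏ φ : primeFactors f, (φ : F[X]) ^ k φ).mirror =
      ∏ φ : primeFactors f, (φ : F[X]).mirror ^ k φ := by
    simp only [← mirrorEquiv_apply, map_prod, map_pow]
  have h2 : ∏ φ : primeFactors f, (φ : F[X]) ^ k (mirrorFactor f hf hm φ) =
      ∏ φ : primeFactors f, (mirrorFactor f hf hm φ : F[X]) ^ k φ := by
    rw [← Equiv.prod_comp hinv.toPerm]
    simp [hinv _]
  rw [h1, h2]
  exact Associated.prod _ _ _ fun φ _ => (associated_mirrorFactor hf hm φ).pow_pow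

theorem ncard_dualCode_subset {N P : ℕ} (hN : (X ^ N - 1 : F[X]) ≠ 0) (hf : f ≠ 0)
    (hsq : Squarefree f) (hfP : X ^ N - 1 = f ^ P) (hm : Associated f.mirror f) :
    {C : Ideal (AdjoinRoot (X ^ N - 1 : F[X])) | dualCode hN C ⊆ ↑C}.ncard =
      Nat.card {k : primeFactors f → ℕ // ∀ φ, k φ + k (mirrorFactor f hf hm φ) ≤ P} := by
  let G : (primeFactors f → ℕ) → F[X] := fun k => ∏ φ : primeFactors f, (φ : F[X]) ^ k φ
  have hG : ∀ k l, G k ∣ G l ↔ k ≤ l := fun k l =>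
    ⟨le_of_prod_pow_dvd (fun φ : primeFactors f => (φ : F[X]))
      (fun φ => (irreducible_of_mem_primeFactors φ.2).prime)
      (fun φ ψ h => Subtype.ext (eq_of_mem_primeFactors_of_dvd φ.2 ψ.2 h)) k l,
    fun h => Finset.prod_dvd_prod_of_dvd _ _ fun φ _ => pow_dvd_pow _ (h φ)⟩
  have hGP : Associated (G fun _ => P) (X ^ N - 1) := by
    rw [hfP]
    simp only [G, Finset.prod_pow]
    exact (associated_prod_primeFactors hsq).pow_pow
  have hGd : ∀ k, G k ∣ X ^ N - 1 ↔ ∀ φ, k φ ≤ P := fun k => by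
    rw [← hGP.dvd_iff_dvd_right, hG]; rfl
  have hGm : ∀ k, G k * (G k).mirror ∣ X ^ N - 1 ↔
      ∀ φ, k φ + k (mirrorFactor f hf hm φ) ≤ P := fun k => by
    rw [((associated_mirror_prod_pow hf hm k).mul_left (G k)).dvd_iff_dvd_left, ← hGd]
    simp only [G, pow_add, Finset.prod_mul_distrib]
  rw [← Nat.card_coe_set_eq]
  symm
  have hdvd : ∀ k : {k : primeFactors f → ℕ // ∀ φ, k φ + k (mirrorFactor f hf hm φ) ≤ P},
      G k.1 ∣ X ^ N - 1 := fun k => (hGd _).2 fun φ => (Nat.le_add_right _ _).trans (k.2 φ)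
  refine Nat.card_eq_of_bijective (fun k => ⟨Ideal.span {AdjoinRoot.mk _ (G k.1)},
    (dualCode_subset_iff hN (hdvd k)).2 ((hGm _).2 k.2)⟩) ⟨fun k l hkl => ?_, fun C => ?_⟩
  · have h : Ideal.span {AdjoinRoot.mk (X ^ N - 1) (G k.1)} =
        Ideal.span {AdjoinRoot.mk _ (G l.1)} :=
      congrArg Subtype.val hkl
    refine Subtype.ext (le_antisymm ?_ ?_)
    · rw [← hG, ← mk_mem_span_mk_iff (hdvd k), h]
      exact Ideal.mem_span_singleton_self _
    · rw [← hG, ← mk_mem_span_mk_iff (hdvd l), ← h]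
      exact Ideal.mem_span_singleton_self _
  · obtain ⟨C, hC⟩ := C
    obtain ⟨g, hg, rfl⟩ := exists_dvd_eq_span_mk _ C
    obtain ⟨k, hk⟩ := exists_associated_prod_pow Finset.univ (fun φ : primeFactors f => (φ : F[X]))
      (fun φ _ => (irreducible_of_mem_primeFactors φ.2).prime) (fun _ => P) g
      (hGP.dvd_iff_dvd_right.2 hg)
    have hspan : Ideal.span {AdjoinRoot.mk (X ^ N - 1) (G k)} = Ideal.span {AdjoinRoot.mk _ g} :=
      le_antisymm (Ideal.span_singleton_le_span_singleton.2 (map_dvd _ hk.dvd))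
        (Ideal.span_singleton_le_span_singleton.2 (map_dvd _ hk.symm.dvd))
    have hkd : G k ∣ X ^ N - 1 := (hk.dvd_iff_dvd_left).1 hg
    refine ⟨⟨k, (hGm k).1 ((dualCode_subset_iff hN hkd).1 ?_)⟩, Subtype.ext hspan⟩
    rw [hspan]
    exact hC

end Factors

section FixedFactors

open UniqueFactorizationMonoid

variable {F : Type*} [Field F]

theorem not_associated_mirror_of_dvd_X_pow_sub_C (h2 : (2 : F) ≠ 0) {c : F} (hc : c ^ 2 = -1)
    {n : ℕ} (hn : 0 < n) {φ : F[X]} (hφ : Irreducible φ) (hm : Associated φ.mirror φ) :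
    ¬ φ ∣ X ^ n - C c := by
  intro h
  have hc0 : c ≠ 0 := by
    rintro rfl
    simp at hc
  have h1 : φ ∣ 1 - C c * X ^ n := by
    rw [← mirror_X_pow_sub_C hn hc0]
    exact hm.symm.dvd.trans (mirror_dvd_mirror h)
  have h3 : C (2 : F) = (1 - C c * X ^ n) + C c * (X ^ n - C c) := by
    have : C c * C c = -1 := by rw [← C_mul, ← pow_two, hc, C_neg, C_1]
    rw [map_ofNat]
    linear_combination this
  have h4 : φ ∣ C (2 : F) := h3 ▸ dvd_add h1 (h.mul_left _)
  exact hφ.not_isUnit (isUnit_of_dvd_unit h4 (isUnit_C.2 h2.isUnit))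

theorem dvd_X_sq_sub_one_of_associated_mirror (h2 : (2 : F) ≠ 0) (hsq : IsSquare (-1 : F))
    {φ : F[X]} (hφ : Irreducible φ) (hm : Associated φ.mirror φ) (r : ℕ)
    (h : φ ∣ X ^ 2 ^ (r + 1) - 1) : φ ∣ X ^ 2 - 1 := by
  induction r with
  | zero => simpa using h
  | succ r ih =>
    obtain ⟨c, hc⟩ := hsq
    have hcc : c ^ 2 = -1 := by rw [hc, pow_two]
    have hC : C c * C c = -1 := by rw [← C_mul, ← hc, C_neg, C_1]
    have hfac : (X ^ 2 ^ (r + 1 + 1) - 1 : F[X]) =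
        (X ^ 2 ^ (r + 1) - 1) * ((X ^ 2 ^ r - C c) * (X ^ 2 ^ r - C (-c))) := by
      rw [C_neg, pow_succ 2 (r + 1), pow_mul, pow_succ 2 r, pow_mul]
      linear_combination ((X ^ 2 ^ r) ^ 2 - 1) * hC
    rw [hfac] at h
    rcases hφ.prime.dvd_or_dvd h with h | h
    · exact ih h
    · rcases hφ.prime.dvd_or_dvd h with h | h
      · exact absurd h (not_associated_mirror_of_dvd_X_pow_sub_C h2 hcc (by positivity) hφ hm)
      · exact absurd h (not_associated_mirror_of_dvd_X_pow_sub_C h2 (by rwa [neg_sq])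
          (by positivity) hφ hm)

theorem associated_mirror_X_sub_C {c : F} (hc : c * c = 1) :
    Associated (X - C c).mirror (X - C c) := by
  have hc0 : c ≠ 0 := left_ne_zero_of_mul_eq_one hc
  have h := mirror_X_pow_sub_C one_pos hc0
  rw [pow_one] at h
  have hC : C c * C c = 1 := by rw [← C_mul, hc, C_1]
  have h' : (X - C c).mirror = (X - C c) * C (-c) := by
    rw [h, C_neg]
    linear_combination -hC
  rw [h']
  exact associated_mul_unit_left _ _ (isUnit_C.2 (neg_ne_zero.2 hc0).isUnit)

variable [DecidableEq F]

theorem mirrorFactor_eq_self_iff {f : F[X]} (hf : f ≠ 0) (hm : Associated f.mirror f)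
    (φ : primeFactors f) :
    mirrorFactor f hf hm φ = φ ↔ Associated (φ : F[X]).mirror φ := by
  constructor
  · intro h
    simpa only [h] using associated_mirrorFactor hf hm φ
  · intro h
    exact Subtype.ext (eq_of_mem_primeFactors_of_dvd (Subtype.prop _) φ.2
      ((associated_mirrorFactor hf hm φ).symm.trans h).dvd)

theorem card_mirrorFactor_fixed (h2 : (2 : F) ≠ 0) (hsq : IsSquare (-1 : F)) (r : ℕ)
    (hf : (X ^ 2 ^ (r + 1) - 1 : F[X]) ≠ 0)
    (hm : Associated (X ^ 2 ^ (r + 1) - 1 : F[X]).mirror (X ^ 2 ^ (r + 1) - 1)) :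
    Nat.card {φ : primeFactors (X ^ 2 ^ (r + 1) - 1 : F[X]) // mirrorFactor _ hf hm φ = φ} = 2 := by
  have hmem : ∀ c : F, c * c = 1 → X - C c ∈ primeFactors (X ^ 2 ^ (r + 1) - 1 : F[X]) := by
    intro c hc
    refine (mem_primeFactors_iff_monic hf).2 ⟨irreducible_X_sub_C c, monic_X_sub_C c, ?_⟩
    rw [dvd_iff_isRoot, IsRoot.def, pow_succ', pow_mul]
    simp [pow_two, hc]
  have h1 : (1 : F) * 1 = 1 := one_mul 1
  have h1' : (-1 : F) * -1 = 1 := by ring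
  rw [Nat.card_eq_two_iff]
  refine ⟨⟨⟨_, hmem 1 h1⟩, (mirrorFactor_eq_self_iff hf hm _).2 (associated_mirror_X_sub_C h1)⟩,
    ⟨⟨_, hmem (-1) h1'⟩, (mirrorFactor_eq_self_iff hf hm _).2 (associated_mirror_X_sub_C h1')⟩,
    ?_, ?_⟩
  · intro h
    have h' : (X - C 1 : F[X]) = X - C (-1) := congrArg (fun x => ((x.1 : _) : F[X])) h
    have h3 : (1 : F) = -1 := C_injective (sub_right_injective h')
    exact h2 (by linear_combination h3)
  · rw [Set.eq_univ_iff_forall]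
    rintro ⟨φ, hφ⟩
    have hirr := irreducible_of_mem_primeFactors φ.2
    have hd := dvd_X_sq_sub_one_of_associated_mirror h2 hsq hirr
      ((mirrorFactor_eq_self_iff hf hm _).1 hφ) r ((mem_primeFactors_iff_monic hf).1 φ.2).2.2
    have hfac : (X ^ 2 - 1 : F[X]) = (X - C 1) * (X - C (-1)) := by
      rw [C_neg, C_1]
      ring
    rw [hfac] at hd
    simp only [Set.mem_insert_iff, Set.mem_singleton_iff, Subtype.ext_iff]
    exact (hirr.prime.dvd_or_dvd hd).imp (eq_of_mem_primeFactors_of_dvd φ.2 (hmem _ h1))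
      (eq_of_mem_primeFactors_of_dvd φ.2 (hmem _ h1'))

end FixedFactors

section CardFactors

open UniqueFactorizationMonoid

theorem orderOf_unitOfCoprime_two_pow {q a b : ℕ} (ha : 2 ≤ a) (hb : Odd b)
    (hq : q = 2 ^ a * b + 1) (k : ℕ) (h : q.Coprime (2 ^ k)) :
    orderOf (ZMod.unitOfCoprime q h) = 2 ^ (k - a) := by
  rw [← orderOf_units, ZMod.coe_unitOfCoprime, hq]
  rcases le_total k a with hk | hk
  · rw [Nat.sub_eq_zero_of_le hk, pow_zero, orderOf_eq_one_iff]
    have : ((2 ^ a : ℕ) : ZMod (2 ^ k)) = 0 :=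
      (ZMod.natCast_eq_zero_iff _ _).2 (pow_dvd_pow 2 hk)
    rw [Nat.cast_add, Nat.cast_mul, this, zero_mul, zero_add, Nat.cast_one]
  · obtain ⟨n, rfl⟩ := Nat.exists_eq_add_of_le' hk
    have hb' : ¬ ((2 : ℕ) : ℤ) ∣ (b : ℤ) := by
      rw [Int.natCast_dvd_natCast]
      exact hb.not_two_dvd_nat
    have := ZMod.orderOf_one_add_mul_prime_pow Nat.prime_two a (by omega) (by omega) (b : ℤ) hb' n
    rw [Nat.add_sub_cancel, ← this]
    congr 1
    push_cast
    ring

variable {F : Type*} [Field F] [DecidableEq F]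

theorem card_primeFactors_X_sub_one : (primeFactors (X ^ 2 ^ 0 - 1 : F[X])).card = 1 := by
  have h : Irreducible (X ^ 2 ^ 0 - 1 : F[X]) := by
    simpa using irreducible_X_sub_C (1 : F)
  rw [← toFinset_normalizedFactors, normalizedFactors_irreducible h, Multiset.toFinset_singleton,
    Finset.card_singleton]

variable [Fintype F]

theorem card_primeFactors_cyclotomic_two_pow {p m a b : ℕ} (hp : p.Prime) (hpodd : Odd p)
    (ha : 2 ≤ a) (hb : Odd b) (hq : p ^ m = 2 ^ a * b + 1) (hF : Fintype.card F = p ^ m) (k : ℕ) :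
    (primeFactors (cyclotomic (2 ^ k) F)).card = (2 ^ k).totient / 2 ^ (k - a) := by
  have : Fact p.Prime := ⟨hp⟩
  have hn : p.Coprime (2 ^ k) := (Nat.coprime_two_right.2 hpodd).pow_right k
  rw [← orderOf_unitOfCoprime_two_pow ha hb hq k (hn.pow_left m),
    ← normalizedFactors_cyclotomic_card hF hn, toFinset_normalizedFactors]

theorem card_primeFactors_X_pow_sub_one_succ {p m a b : ℕ} (hp : p.Prime) (hpodd : Odd p)
    (ha : 2 ≤ a) (hb : Odd b) (hq : p ^ m = 2 ^ a * b + 1) (hF : Fintype.card F = p ^ m)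
    (h2 : (2 : F) ≠ 0) (r : ℕ) :
    (primeFactors (X ^ 2 ^ (r + 1) - 1 : F[X])).card =
      2 ^ r / 2 ^ (r + 1 - a) + (primeFactors (X ^ 2 ^ r - 1 : F[X])).card := by
  have : Fact (Nat.Prime 2) := ⟨Nat.prime_two⟩
  have hsep : (X ^ 2 ^ (r + 1) - 1 : F[X]).Separable :=
    X_pow_sub_one_separable_iff.2 (by exact_mod_cast pow_ne_zero _ h2)
  rw [← cyclotomic_prime_pow_mul_X_pow_sub_one] at hsep ⊢
  rw [primeFactors_mul_eq_disjUnion hsep.isCoprime.isRelPrime, Finset.card_disjUnion,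
    card_primeFactors_cyclotomic_two_pow hp hpodd ha hb hq hF,
    Nat.totient_prime_pow_succ Nat.prime_two]
  simp

theorem card_primeFactors_X_pow_sub_one_of_le {p m a b : ℕ} (hp : p.Prime) (hpodd : Odd p)
    (ha : 2 ≤ a) (hb : Odd b) (hq : p ^ m = 2 ^ a * b + 1) (hF : Fintype.card F = p ^ m)
    (h2 : (2 : F) ≠ 0) (r : ℕ) (hr : r ≤ a) :
    (primeFactors (X ^ 2 ^ r - 1 : F[X])).card = 2 ^ r := by
  induction r with
  | zero => rw [card_primeFactors_X_sub_one, pow_zero]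
  | succ r ih =>
    rw [card_primeFactors_X_pow_sub_one_succ hp hpodd ha hb hq hF h2, ih (by omega),
      Nat.sub_eq_zero_of_le hr, pow_zero, Nat.div_one, pow_succ, mul_two]

theorem card_primeFactors_X_pow_sub_one_add {p m a b : ℕ} (hp : p.Prime) (hpodd : Odd p)
    (ha : 2 ≤ a) (hb : Odd b) (hq : p ^ m = 2 ^ a * b + 1) (hF : Fintype.card F = p ^ m)
    (h2 : (2 : F) ≠ 0) (d : ℕ) :
    (primeFactors (X ^ 2 ^ (a + d) - 1 : F[X])).card = 2 ^ a + d * 2 ^ (a - 1) := by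
  induction d with
  | zero => simpa using card_primeFactors_X_pow_sub_one_of_le hp hpodd ha hb hq hF h2 a le_rfl
  | succ d ih =>
    rw [← add_assoc, card_primeFactors_X_pow_sub_one_succ hp hpodd ha hb hq hF h2, ih,
      Nat.pow_div (by omega) two_pos, show a + d - (a + d + 1 - a) = a - 1 by omega]
    ring

end CardFactors

theorem ncard_dualCode_subset_of_card_primeFactors {p s r M N : ℕ} {F : Type*} [Field F]
    [Fintype F] [DecidableEq F] (hp : p.Prime) (hpodd : Odd p) [CharP F p]
    (hsq : IsSquare (-1 : F)) (h2 : (2 : F) ≠ 0) (hN : N = 2 ^ (r + 1) * p ^ s)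
    (hf : (X ^ N - 1 : F[X]) ≠ 0)
    (hcard : (UniqueFactorizationMonoid.primeFactors (X ^ 2 ^ (r + 1) - 1 : F[X])).card =
      2 * M + 2) :
    {C : Ideal (AdjoinRoot (X ^ N - 1 : F[X])) | dualCode hf C ⊆ ↑C}.ncard =
      (p ^ s + 2) ^ M * ((p ^ s + 1) / 2) ^ (M + 2) := by
  have : Fact p.Prime := ⟨hp⟩
  have hsep : (X ^ 2 ^ (r + 1) - 1 : F[X]).Separable :=
    X_pow_sub_one_separable_iff.2 (by exact_mod_cast pow_ne_zero _ h2)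
  have hm : Associated (X ^ 2 ^ (r + 1) - 1 : F[X]).mirror (X ^ 2 ^ (r + 1) - 1) := by
    rw [mirror_X_pow_sub_one (by positivity)]
    exact (Associated.refl _).neg_left
  have hfP : (X ^ N - 1 : F[X]) = (X ^ 2 ^ (r + 1) - 1) ^ p ^ s := by
    rw [sub_pow_char_pow, one_pow, ← pow_mul, hN]
  rw [ncard_dualCode_subset hf hsep.ne_zero hsep.squarefree hfP hm]
  refine card_involution_bounded _ (mirrorFactor_involutive _ hm) _ _ hpodd.pow
    (card_mirrorFactor_fixed h2 hsq r hsep.ne_zero hm) ?_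
  rw [Nat.card_eq_fintype_card, Fintype.card_coe, hcard]

/-- for `q = p^m = 2^a·b+1`, the number of cyclic codes (ideals) `C` of
`F_q[x]/(x^{2^r·p^s} − 1)` with `C^⊥ ⊆ C` is
`(p^s+2)^{2^{r−1}−1}·((p^s+1)/2)^{2^{r−1}+1}` if `r ≤ a`, and
`(p^s+2)^{2^{a−1}+(r−a)2^{a−2}−1}·((p^s+1)/2)^{2^{a−1}+(r−a)2^{a−2}+1}` if `r > a`. -/
theorem stmt11 (p m a b r s : ℕ) (hp : p.Prime) (hpodd : Odd p) (hm : 0 < m) (hs : 0 < s)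
    (hb : Odd b) (ha : 2 ≤ a) (hr : 2 ≤ r) (hq : p ^ m = 2 ^ a * b + 1)
    (F : Type*) [Field F] [Fintype F] (hF : Fintype.card F = p ^ m)
    (N : ℕ) (hN : N = 2 ^ r * p ^ s) (hf : (X ^ N - 1 : Polynomial F) ≠ 0) :
    (r ≤ a →
      {C : Ideal (AdjoinRoot (X ^ N - 1 : Polynomial F)) | dualCode hf C ⊆ ↑C}.ncard =
        (p ^ s + 2) ^ (2 ^ (r - 1) - 1) * ((p ^ s + 1) / 2) ^ (2 ^ (r - 1) + 1)) ∧
    (a < r →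
      {C : Ideal (AdjoinRoot (X ^ N - 1 : Polynomial F)) | dualCode hf C ⊆ ↑C}.ncard =
        (p ^ s + 2) ^ (2 ^ (a - 1) + (r - a) * 2 ^ (a - 2) - 1) *
          ((p ^ s + 1) / 2) ^ (2 ^ (a - 1) + (r - a) * 2 ^ (a - 2) + 1)) := by
  classical
  have : Fact p.Prime := ⟨hp⟩
  have : CharP F p := charP_of_card_eq_prime_pow hF
  have h2 : (2 : F) ≠ 0 := by
    intro h
    have := (CharP.cast_eq_zero_iff F p 2).1 (by exact_mod_cast h)
    have := (Nat.prime_dvd_prime_iff_eq hp Nat.prime_two).1 this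
    subst this
    exact absurd hpodd (by decide)
  have hsq : IsSquare (-1 : F) := by
    rw [FiniteField.isSquare_neg_one_iff, hF, hq]
    obtain ⟨a, rfl⟩ := Nat.exists_eq_add_of_le' ha
    rw [pow_add, mul_right_comm]
    omega
  obtain ⟨t, rfl⟩ := Nat.exists_eq_add_of_le' hr
  obtain ⟨d, rfl⟩ := Nat.exists_eq_add_of_le' ha
  constructor
  · intro hle
    have hcard := card_primeFactors_X_pow_sub_one_of_le hp hpodd ha hb hq hF h2 _ hle
    have hpos := Nat.one_le_two_pow (n := t + 1)
    rw [ncard_dualCode_subset_of_card_primeFactors (r := t + 1) (M := 2 ^ (t + 1) - 1)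
      hp hpodd hsq h2 hN hf (by rw [hcard, pow_succ 2 (t + 1)]; omega)]
    congr 2
    change 2 ^ (t + 1) - 1 + 2 = 2 ^ (t + 1) + 1
    omega
  · intro hlt
    obtain ⟨e, he⟩ := Nat.exists_eq_add_of_lt hlt
    have hcard := card_primeFactors_X_pow_sub_one_add hp hpodd ha hb hq hF h2 (e + 1)
    rw [← add_assoc, ← he] at hcard
    have hpos := Nat.one_le_two_pow (n := d + 1)
    have hsub : t + 2 - (d + 2) = e + 1 := by omega
    rw [hsub]
    rw [ncard_dualCode_subset_of_card_primeFactors (r := t + 1)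
      (M := 2 ^ (d + 2 - 1) + (e + 1) * 2 ^ (d + 2 - 2) - 1) hp hpodd hsq h2 hN hf ?_]
    · congr 2
      simp only [Nat.add_sub_cancel, Nat.add_succ_sub_one]
      omega
    · rw [hcard]
      simp only [Nat.add_sub_cancel, Nat.add_succ_sub_one]
      have h3 : 2 ^ (d + 2) + (e + 1) * 2 ^ (d + 1) = 2 * (2 ^ (d + 1) + (e + 1) * 2 ^ d) := by
        ring
      omega
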